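/- arXiv:1908.02888 — 2 statements merged into one kernel-verified Lean document; each statement's English description precedes it below -/
import Mathlib

section
/- Let h, α, δ be real constants with 1/2 < h < 1, α > 0 and δ > 0, and for x > 0 set η̃(x) = x^{-2h}·exp( (2α/(1-2h))·x^{1-2h} - (δ/(1-h))·x^{2-2h} ). Then lim_{x → ∞} [ -log( ∫_x^∞ η̃(s) ds ) ] / x^{2-2h} = δ/(1-h). -/
open Real Set MeasureTheory Filter Topology

/-- The (unnormalized) invariant density of the generalized CIR model. -/
noncomputable def etaT (h α δ x : ℝ) : ℝ :=
  x ^ (-(2*h)) * Real.exp ((2*α/(1-2*h)) * x ^ (1-2*h) - (δ/(1-h)) * x ^ (2-2*h))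

lemma etaT_nonneg (h α δ : ℝ) {x : ℝ} (hx : 0 < x) : 0 ≤ etaT h α δ x := by
  unfold etaT; positivity

lemma etaT_le {h α δ x s : ℝ} (hh1 : 1/2 < h) (hh2 : h < 1) (hα : 0 < α) (hδ : 0 < δ)
    (hx : 0 < x) (hs : x ≤ s) :
    etaT h α δ s ≤ s ^ (-(2*h)) * Real.exp (-(δ/(1-h) * x ^ (2-2*h))) := by
  have hs0 : 0 < s := hx.trans_le hs
  have hA : 2*α/(1-2*h) ≤ 0 := div_nonpos_of_nonneg_of_nonpos (by linarith) (by linarith)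
  have hc : 0 ≤ δ/(1-h) := div_nonneg hδ.le (by linarith)
  have h1 : 2*α/(1-2*h) * s ^ (1-2*h) ≤ 0 := mul_nonpos_of_nonpos_of_nonneg hA (by positivity)
  have h2 : x ^ (2-2*h) ≤ s ^ (2-2*h) := Real.rpow_le_rpow hx.le hs (by linarith)
  have h3 := mul_le_mul_of_nonneg_left h2 hc
  unfold etaT
  gcongr
  linarith

lemma le_etaT {h α δ x s : ℝ} (hh1 : 1/2 < h) (hh2 : h < 1) (hα : 0 < α) (hδ : 0 < δ)
    (hs1 : 1 ≤ s) (hs : s ≤ x) :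
    x ^ (-(2*h)) * Real.exp (2*α/(1-2*h) - δ/(1-h) * x ^ (2-2*h)) ≤ etaT h α δ s := by
  have hs0 : 0 < s := by linarith
  have hA : 2*α/(1-2*h) ≤ 0 := div_nonpos_of_nonneg_of_nonpos (by linarith) (by linarith)
  have hc : 0 ≤ δ/(1-h) := div_nonneg hδ.le (by linarith)
  have h1 : s ^ (1-2*h) ≤ 1 := Real.rpow_le_one_of_one_le_of_nonpos hs1 (by linarith)
  have h2 : s ^ (2-2*h) ≤ x ^ (2-2*h) := Real.rpow_le_rpow hs0.le hs (by linarith)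
  have h3 := mul_le_mul_of_nonneg_left h2 hc
  have h4 := mul_le_mul_of_nonpos_left h1 hA
  have h5 : x ^ (-(2*h)) ≤ s ^ (-(2*h)) :=
    Real.rpow_le_rpow_of_nonpos hs0 hs (by linarith)
  unfold etaT
  gcongr
  linarith

lemma integrableOn_etaT {h α δ x : ℝ} (hh1 : 1/2 < h) (hh2 : h < 1) (hα : 0 < α) (hδ : 0 < δ)
    (hx : 0 < x) : IntegrableOn (etaT h α δ) (Ioi x) := by
  have hint := (integrableOn_Ioi_rpow_of_lt (a := -(2*h)) (by linarith) hx).mul_const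
    (Real.exp (-(δ/(1-h) * x ^ (2-2*h))))
  refine Integrable.mono' hint ?_ ?_
  · unfold etaT; fun_prop
  · filter_upwards [ae_restrict_mem measurableSet_Ioi] with s hs
    rw [Real.norm_of_nonneg (etaT_nonneg h α δ (hx.trans hs))]
    exact etaT_le hh1 hh2 hα hδ hx hs.le

lemma integral_etaT_le {h α δ x : ℝ} (hh1 : 1/2 < h) (hh2 : h < 1) (hα : 0 < α) (hδ : 0 < δ)
    (hx : 1 ≤ x) :
    ∫ s in Ioi x, etaT h α δ s ≤ 1/(2*h-1) * Real.exp (-(δ/(1-h) * x ^ (2-2*h))) := by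
  have hx0 : 0 < x := by linarith
  calc ∫ s in Ioi x, etaT h α δ s
      ≤ ∫ s in Ioi x, s ^ (-(2*h)) * Real.exp (-(δ/(1-h) * x ^ (2-2*h))) :=
        setIntegral_mono_on (integrableOn_etaT hh1 hh2 hα hδ hx0)
          ((integrableOn_Ioi_rpow_of_lt (by linarith) hx0).mul_const _) measurableSet_Ioi
          fun s hs => etaT_le hh1 hh2 hα hδ hx0 (le_of_lt hs)
    _ = x ^ (1-2*h) / (2*h-1) * Real.exp (-(δ/(1-h) * x ^ (2-2*h))) := by
        rw [integral_mul_const, integral_Ioi_rpow_of_lt (by linarith) hx0, neg_div,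
          ← div_neg]
        ring_nf
    _ ≤ _ := by
        gcongr
        · linarith
        · exact Real.rpow_le_one_of_one_le_of_nonpos hx (by linarith)

lemma le_integral_etaT {h α δ x : ℝ} (hh1 : 1/2 < h) (hh2 : h < 1) (hα : 0 < α) (hδ : 0 < δ)
    (hx : 1 ≤ x) :
    (x+1) ^ (-(2*h)) * Real.exp (2*α/(1-2*h) - δ/(1-h) * (x+1) ^ (2-2*h)) ≤
      ∫ s in Ioi x, etaT h α δ s := by
  have hx0 : 0 < x := by linarith
  have hint := integrableOn_etaT hh1 hh2 hα hδ hx0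
  set C := (x+1) ^ (-(2*h)) * Real.exp (2*α/(1-2*h) - δ/(1-h) * (x+1) ^ (2-2*h))
  calc C = ∫ _ in Ioc x (x+1), C := by simp
    _ ≤ ∫ s in Ioc x (x+1), etaT h α δ s :=
        setIntegral_mono_on (by simp) (hint.mono_set Ioc_subset_Ioi_self) measurableSet_Ioc
          fun s hs => le_etaT hh1 hh2 hα hδ (hx.trans hs.1.le) hs.2
    _ ≤ ∫ s in Ioi x, etaT h α δ s :=
        setIntegral_mono_set hint
          ((ae_restrict_mem measurableSet_Ioi).mono fun s hs => etaT_nonneg h α δ (hx0.trans hs))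
          Ioc_subset_Ioi_self.eventuallyLE

lemma le_neg_log_integral_etaT {h α δ x : ℝ} (hh1 : 1/2 < h) (hh2 : h < 1) (hα : 0 < α)
    (hδ : 0 < δ) (hx : 1 ≤ x) :
    δ/(1-h) * x ^ (2-2*h) + Real.log (2*h-1) ≤ -Real.log (∫ s in Ioi x, etaT h α δ s) := by
  have hx1 : 0 < x + 1 := by linarith
  have hpos : 0 < ∫ s in Ioi x, etaT h α δ s :=
    lt_of_lt_of_le (by positivity) (le_integral_etaT hh1 hh2 hα hδ hx)
  have h1 : 0 < 2*h-1 := by linarith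
  have := Real.log_le_log hpos (integral_etaT_le hh1 hh2 hα hδ hx)
  rw [Real.log_mul (by positivity) (by positivity), Real.log_exp, one_div, Real.log_inv] at this
  linarith

lemma neg_log_integral_etaT_le {h α δ x : ℝ} (hh1 : 1/2 < h) (hh2 : h < 1) (hα : 0 < α)
    (hδ : 0 < δ) (hx : 1 ≤ x) :
    -Real.log (∫ s in Ioi x, etaT h α δ s) ≤
      δ/(1-h) * x ^ (2-2*h) + 2*h * Real.log x
        + (2*h * Real.log 2 + δ/(1-h) - 2*α/(1-2*h)) := by
  have hx0 : 0 < x := by linarith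
  have hx1 : 0 < x + 1 := by linarith
  have hc : 0 ≤ δ/(1-h) := div_nonneg hδ.le (by linarith)
  have h1 := Real.log_le_log (by positivity) (le_integral_etaT hh1 hh2 hα hδ hx)
  rw [Real.log_mul (by positivity) (by positivity), Real.log_exp, Real.log_rpow hx1] at h1
  have h2 : Real.log (x+1) ≤ Real.log 2 + Real.log x := by
    rw [← Real.log_mul two_ne_zero hx0.ne']
    exact Real.log_le_log hx1 (by linarith)
  have h3 : (x+1) ^ (2-2*h) ≤ x ^ (2-2*h) + 1 := by
    simpa using Real.rpow_add_le_add_rpow hx0.le zero_le_one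
      (show 0 ≤ 2-2*h by linarith) (show 2-2*h ≤ 1 by linarith)
  have h4 := mul_le_mul_of_nonneg_left h3 hc
  have h5 := mul_le_mul_of_nonneg_left h2 (show 0 ≤ 2*h by linarith)
  linarith

theorem stmt_11 (h α δ : ℝ) (hh1 : 1/2 < h) (hh2 : h < 1) (hα : 0 < α) (hδ : 0 < δ) :
    Tendsto (fun x : ℝ =>
        (-Real.log (∫ s in Set.Ioi x, etaT h α δ s)) / x ^ (2-2*h))
      atTop (𝓝 (δ/(1-h))) := by
  have hp : 0 < 2-2*h := by linarith
  have hconst (K : ℝ) : Tendsto (fun x : ℝ => K / x ^ (2-2*h)) atTop (𝓝 0) :=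
    (tendsto_rpow_atTop hp).const_div_atTop K
  have hlog : Tendsto (fun x : ℝ => Real.log x / x ^ (2-2*h)) atTop (𝓝 0) :=
    (isLittleO_log_rpow_atTop hp).tendsto_div_nhds_zero
  have hlower : Tendsto (fun x : ℝ => δ/(1-h) + Real.log (2*h-1) / x ^ (2-2*h)) atTop
      (𝓝 (δ/(1-h))) := by
    simpa using (hconst (Real.log (2*h-1))).const_add (δ/(1-h))
  have hupper : Tendsto (fun x : ℝ => δ/(1-h) + 2*h * (Real.log x / x ^ (2-2*h))
      + (2*h * Real.log 2 + δ/(1-h) - 2*α/(1-2*h)) / x ^ (2-2*h)) atTop (𝓝 (δ/(1-h))) := by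
    simpa using ((hlog.const_mul (2*h)).const_add (δ/(1-h))).add
      (hconst (2*h * Real.log 2 + δ/(1-h) - 2*α/(1-2*h)))
  refine tendsto_of_tendsto_of_tendsto_of_le_of_le' hlower hupper ?_ ?_
  · filter_upwards [eventually_ge_atTop 1] with x hx
    have hxp : 0 < x ^ (2-2*h) := Real.rpow_pos_of_pos (by linarith) _
    rw [le_div_iff₀ hxp, add_mul, div_mul_cancel₀ _ hxp.ne']
    exact le_neg_log_integral_etaT hh1 hh2 hα hδ hx
  · filter_upwards [eventually_ge_atTop 1] with x hx
    have hxp : 0 < x ^ (2-2*h) := Real.rpow_pos_of_pos (by linarith) _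
    rw [div_le_iff₀ hxp, add_mul, add_mul, mul_assoc, div_mul_cancel₀ _ hxp.ne',
      div_mul_cancel₀ _ hxp.ne']
    exact neg_log_integral_etaT_le hh1 hh2 hα hδ hx
end

section
/- Let h, α, δ be real constants with 1/2 < h < 1, α > 0 and δ > 0, for x > 0 set η̃(x) = x^{-2h}·exp( (2α/(1-2h))·x^{1-2h} - (δ/(1-h))·x^{2-2h} ), let Z = ∫₀^∞ η̃(x) dx, and let μ be the probability measure on (0,∞) with density η = η̃/Z with respect to Lebesgue measure. Then there exists a constant C > 0 such that for every r > 0 and every continuously differentiable function f : ℝ → ℝ with compact support, ∫₀^∞ f(x)² dμ(x) ≤ (r/2)·∫₀^∞ x^{2h}·f'(x)² dμ(x) + exp(C·(1 + 1/r))·( ∫₀^∞ |f(x)| dμ(x) )². -/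
open Real Set MeasureTheory Filter Topology

/-- The normalizing constant of the invariant density. -/
noncomputable def Zcst (h α δ : ℝ) : ℝ := ∫ x in Set.Ioi (0:ℝ), etaT h α δ x

/-- The normalized invariant density `η = η̃ / Z`. -/
noncomputable def etaN (h α δ x : ℝ) : ℝ := etaT h α δ x / Zcst h α δ

/-- The exponent of the unnormalized invariant density. -/
noncomputable def cirExponent (h α δ x : ℝ) : ℝ :=
  (2*α/(1-2*h)) * x ^ (1-2*h) - (δ/(1-h)) * x ^ (2-2*h)

/-- Minus one half of the derivative of `cirExponent`. -/
noncomputable def cirDrift (h α δ x : ℝ) : ℝ := -(α - δ*x) * x ^ (-(2*h))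

/-- The derivative of `cirDrift`. -/
noncomputable def cirDriftDeriv (h α δ x : ℝ) : ℝ :=
  δ * x ^ (-(2*h)) + 2*h*(α - δ*x) * x ^ (-(2*h) - 1)

lemma etaT_eq (h α δ x : ℝ) :
    etaT h α δ x = x ^ (-(2*h)) * Real.exp (cirExponent h α δ x) := rfl

lemma etaT_pos (h α δ : ℝ) {x : ℝ} (hx : 0 < x) : 0 < etaT h α δ x := by
  unfold etaT; positivity

lemma exp_cirExponent_eq (h α δ : ℝ) {x : ℝ} (hx : 0 < x) :
    Real.exp (cirExponent h α δ x) = x ^ (2*h) * etaT h α δ x := by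
  rw [etaT_eq, ← mul_assoc, ← Real.rpow_add hx]; simp

lemma hasDerivAt_cirExponent {h : ℝ} (α δ : ℝ) {x : ℝ} (h1 : 1 - 2*h ≠ 0) (h2 : 1 - h ≠ 0)
    (hx : 0 < x) :
    HasDerivAt (cirExponent h α δ) (-2 * cirDrift h α δ x) x := by
  have d1 := (Real.hasDerivAt_rpow_const (x := x) (p := 1-2*h) (Or.inl hx.ne')).const_mul
    (2*α/(1-2*h))
  have d2 := (Real.hasDerivAt_rpow_const (x := x) (p := 2-2*h) (Or.inl hx.ne')).const_mul
    (δ/(1-h))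
  refine (d1.sub d2).congr_deriv ?_
  have e1 : x ^ (1 - 2*h - 1) = x ^ (-(2*h)) := by congr 1; ring
  have e2 : x ^ (2 - 2*h - 1) = x * x ^ (-(2*h)) := by
    rw [show 2 - 2*h - 1 = 1 + -(2*h) by ring, Real.rpow_add hx, Real.rpow_one]
  rw [e1, e2, cirDrift]
  field_simp

lemma hasDerivAt_cirDrift (h α δ : ℝ) {x : ℝ} (hx : 0 < x) :
    HasDerivAt (cirDrift h α δ) (cirDriftDeriv h α δ x) x := by
  have d1 := Real.hasDerivAt_rpow_const (x := x) (p := -(2*h)) (Or.inl hx.ne')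
  have d2 : HasDerivAt (fun y : ℝ => -(α - δ*y)) (-(-(δ*1))) x :=
    (((hasDerivAt_id x).const_mul δ).const_sub α).neg
  refine (d2.mul d1).congr_deriv ?_
  rw [cirDriftDeriv]
  ring

lemma continuousOn_rpow_Ioi (p : ℝ) : ContinuousOn (fun x : ℝ => x ^ p) (Ioi 0) :=
  fun x hx => (Real.continuousAt_rpow_const x p (Or.inl (ne_of_gt hx))).continuousWithinAt

lemma continuousOn_cirExponent (h α δ : ℝ) : ContinuousOn (cirExponent h α δ) (Ioi 0) := by
  unfold cirExponent
  exact (continuousOn_const.mul (continuousOn_rpow_Ioi _)).sub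
    (continuousOn_const.mul (continuousOn_rpow_Ioi _))

lemma continuousOn_cirDrift (h α δ : ℝ) : ContinuousOn (cirDrift h α δ) (Ioi 0) :=
  fun _ hx => (hasDerivAt_cirDrift h α δ hx).continuousAt.continuousWithinAt

lemma continuousOn_cirDriftDeriv (h α δ : ℝ) : ContinuousOn (cirDriftDeriv h α δ) (Ioi 0) := by
  unfold cirDriftDeriv
  exact (continuousOn_const.mul (continuousOn_rpow_Ioi _)).add
    ((Continuous.continuousOn (by fun_prop)).mul (continuousOn_rpow_Ioi _))

/-- A more singular power dominates a less singular one up to a small factor and a constant. -/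
lemma exists_rpow_le_mul_rpow_add {a b s : ℝ} (hab : a < b) (hb : b ≤ 0) (hs : 0 < s) :
    ∃ C : ℝ, 0 ≤ C ∧ ∀ x : ℝ, 0 < x → x ^ b ≤ s * x ^ a + C := by
  have hx₀ : 0 < s ^ (1/(b-a)) := by positivity
  refine ⟨(s ^ (1/(b-a))) ^ b, by positivity, fun x hx => ?_⟩
  rcases le_total x (s ^ (1/(b-a))) with hle | hle
  · have h1 : x ^ (b-a) ≤ s := by
      calc x ^ (b-a) ≤ (s ^ (1/(b-a))) ^ (b-a) :=
            Real.rpow_le_rpow hx.le hle (by linarith)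
        _ = s := by
            rw [← Real.rpow_mul hs.le, one_div_mul_cancel (by linarith), Real.rpow_one]
    have h2 : x ^ b = x ^ (b-a) * x ^ a := by rw [← Real.rpow_add hx]; simp
    have h3 : x ^ (b-a) * x ^ a ≤ s * x ^ a := by gcongr
    have : 0 ≤ (s ^ (1/(b-a))) ^ b := by positivity
    linarith
  · have h1 := Real.rpow_le_rpow_of_nonpos hx₀ hle hb
    have : 0 ≤ s * x ^ a := by positivity
    linarith

/-- The Schrödinger potential of the ground state transform dominates `x ^ (-2h) + x ^ (2-2h)`
up to constants. -/
lemma exists_le_potential {h α δ : ℝ} (hh1 : 1/2 < h) (hα : 0 < α) (hδ : 0 < δ) :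
    ∃ C₁ C₂ : ℝ, 0 < C₁ ∧ 0 ≤ C₂ ∧ ∀ x : ℝ, 0 < x →
      (x ^ (-(2*h)) + x ^ (2-2*h)) * x ^ (-(2*h)) ≤
        C₁ * (cirDrift h α δ x ^ 2 - cirDriftDeriv h α δ x) + C₂ * x ^ (-(2*h)) := by
  obtain ⟨A, hA, hA'⟩ := exists_rpow_le_mul_rpow_add (a := -(2*h)) (b := -1)
    (s := α / (8*h)) (by linarith) (by norm_num) (by positivity)
  obtain ⟨B, hB, hB'⟩ := exists_rpow_le_mul_rpow_add (a := -(2*h)) (b := 1-2*h)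
    (s := α / (8*δ)) (by linarith) (by linarith) (by positivity)
  set c := min (α^2/2) (δ^2) with hc
  have hc0 : 0 < c := by rw [hc]; positivity
  refine ⟨1/c, (2*h*α*A + 2*α*δ*B)/c, by positivity, by positivity, fun x hx => ?_⟩
  have e1 : x ^ (-(2*h) - 1) = x ^ (-1:ℝ) * x ^ (-(2*h)) := by
    rw [← Real.rpow_add hx]; congr 1; ring
  have e2 : x ^ (1 - 2*h) = x * x ^ (-(2*h)) := by
    rw [sub_eq_add_neg, Real.rpow_add hx, Real.rpow_one]
  have e3 : x ^ (2 - 2*h) = x^2 * x ^ (-(2*h)) := by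
    rw [sub_eq_add_neg, Real.rpow_add hx, Real.rpow_two]
  have e4 : x * x ^ (-1:ℝ) = 1 := by
    rw [Real.rpow_neg_one]; field_simp
  have hpos : 0 < x ^ (-(2*h)) := by positivity
  have hpos' : 0 < x ^ (2-2*h) := by positivity
  have key : c * (x ^ (-(2*h)) + x ^ (2-2*h)) ≤
      -(2*h*α) * x ^ (-1:ℝ) + (2*h-1)*δ + α^2 * x ^ (-(2*h)) - 2*α*δ * x^(1-2*h)
        + δ^2 * x^(2-2*h) + (2*h*α*A + 2*α*δ*B) := by
    have k1 : c * x ^ (-(2*h)) ≤ α^2/2 * x ^ (-(2*h)) := by gcongr; exact min_le_left _ _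
    have k2 : c * x ^ (2-2*h) ≤ δ^2 * x ^ (2-2*h) := by gcongr; exact min_le_right _ _
    have k3 : 2*h*α * x ^ (-1:ℝ) ≤ α^2/4 * x ^ (-(2*h)) + 2*h*α*A := by
      calc _ ≤ 2*h*α * (α / (8*h) * x ^ (-(2*h)) + A) := by gcongr; exact hA' x hx
        _ = _ := by field_simp; ring
    have k4 : 2*α*δ * x ^ (1-2*h) ≤ α^2/4 * x ^ (-(2*h)) + 2*α*δ*B := by
      calc _ ≤ 2*α*δ * (α / (8*δ) * x ^ (-(2*h)) + B) := by gcongr; exact hB' x hx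
        _ = _ := by field_simp; ring
    have k5 : 0 ≤ (2*h-1)*δ := mul_nonneg (by linarith) hδ.le
    linarith
  have hV : cirDrift h α δ x ^ 2 - cirDriftDeriv h α δ x =
      (-(2*h*α) * x ^ (-1:ℝ) + (2*h-1)*δ + α^2 * x ^ (-(2*h)) - 2*α*δ * x^(1-2*h)
        + δ^2 * x^(2-2*h)) * x ^ (-(2*h)) := by
    rw [cirDrift, cirDriftDeriv, e1, e2, e3]
    linear_combination (2*h*δ*x ^ (-(2*h))) * e4
  rw [hV]
  have := mul_le_mul_of_nonneg_right key hpos.le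
  rw [← mul_le_mul_iff_right₀ hc0, ← mul_assoc]
  refine this.trans_eq ?_
  field_simp

/-- Lower bounds for the weights where `x ^ (-2h)` and `x ^ (2-2h)` are controlled. -/
lemma exists_exp_neg_le_weights {h α δ : ℝ} (hh1 : 1/2 < h) (hh2 : h < 1) (hα : 0 < α)
    (hδ : 0 < δ) :
    ∃ c : ℝ, 0 < c ∧ ∀ S x : ℝ, 0 < x → x ^ (-(2*h)) + x ^ (2-2*h) ≤ S →
      Real.exp (-(c*S)) ≤ Real.exp (cirExponent h α δ x) ∧
      Real.exp (-(c*S)) ≤ etaT h α δ x := by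
  have p1 : 0 < 2*h-1 := by linarith
  have p2 : 0 < 1-h := by linarith
  refine ⟨2*α/(2*h-1) + δ/(1-h) + h/(1-h), by positivity, fun S x hx hS => ?_⟩
  have e2 : x ^ (1 - 2*h) = x * x ^ (-(2*h)) := by
    rw [sub_eq_add_neg, Real.rpow_add hx, Real.rpow_one]
  have e3 : x ^ (2 - 2*h) = x^2 * x ^ (-(2*h)) := by
    rw [sub_eq_add_neg, Real.rpow_add hx, Real.rpow_two]
  have hpos : 0 < x ^ (-(2*h)) := by positivity
  have hpos' : 0 < x ^ (2-2*h) := by positivity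
  have b1 : x ^ (1-2*h) ≤ S := by
    refine le_trans ?_ hS
    rw [e2, e3]
    nlinarith [sq_nonneg (x-1), mul_nonneg hpos.le (sq_nonneg (x-1))]
  have b2 : x ^ (2-2*h) ≤ S := by linarith
  have b3 : Real.log x ≤ S / (2-2*h) :=
    (Real.log_le_rpow_div hx.le (by linarith)).trans (div_le_div_of_nonneg_right b2 (by linarith))
  have hS0 : 0 ≤ S := by linarith
  have c1 : 2*α/(2*h-1) * x ^ (1-2*h) ≤ 2*α/(2*h-1) * S := by gcongr
  have c2 : δ/(1-h) * x ^ (2-2*h) ≤ δ/(1-h) * S := by gcongr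
  have c3 : 2*h*Real.log x ≤ h/(1-h) * S := by
    calc 2*h*Real.log x ≤ 2*h*(S/(2-2*h)) := by gcongr
      _ = _ := by rw [show 2-2*h = 2*(1-h) by ring]; field_simp
  have c4 : 0 ≤ h/(1-h) * S := by positivity
  have hU : -(2*α/(2*h-1) * S) - δ/(1-h) * S ≤ cirExponent h α δ x := by
    rw [cirExponent, show 1-2*h = -(2*h-1) by ring, div_neg, show -(2*h-1) = 1-2*h by ring]
    linarith
  constructor
  · apply Real.exp_le_exp.2
    linarith
  · rw [etaT_eq, Real.rpow_def_of_pos hx, ← Real.exp_add]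
    apply Real.exp_le_exp.2
    linarith

lemma sq_sub_le_mul_integral_sq_deriv {f : ℝ → ℝ} (hf : ContDiff ℝ 1 f) {x y : ℝ}
    (hxy : x ≤ y) : (f y - f x) ^ 2 ≤ (y - x) * ∫ t in x..y, deriv f t ^ 2 := by
  rcases hxy.eq_or_lt with rfl | hlt
  · simp
  have hd : Continuous (deriv f) := hf.continuous_deriv le_rfl
  have hI : ∫ t in x..y, deriv f t = f y - f x :=
    intervalIntegral.integral_deriv_eq_sub
      (fun t _ => (hf.differentiable one_ne_zero).differentiableAt) (hd.intervalIntegrable _ _)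
  set m := (f y - f x) / (y - x) with hm
  have h0 : 0 ≤ ∫ t in x..y, (deriv f t - m) ^ 2 :=
    intervalIntegral.integral_nonneg hxy fun t _ => sq_nonneg _
  have h1 : ∫ t in x..y, (deriv f t - m) ^ 2 =
      (∫ t in x..y, deriv f t ^ 2) - 2*m*(f y - f x) + m^2*(y-x) := by
    have : ∀ t, (deriv f t - m) ^ 2 = deriv f t ^ 2 - 2*m*deriv f t + m^2 := fun t => by ring
    simp_rw [this]
    rw [intervalIntegral.integral_add, intervalIntegral.integral_sub,
      intervalIntegral.integral_const_mul, hI, intervalIntegral.integral_const, smul_eq_mul]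
    · ring
    all_goals exact Continuous.intervalIntegrable (by fun_prop) _ _
  have hyx : 0 < y - x := sub_pos.2 hlt
  have hm' : m * (y - x) = f y - f x := div_mul_cancel₀ _ hyx.ne'
  rw [h1] at h0
  have := mul_nonneg hyx.le h0
  rw [← hm'] at this ⊢
  linarith

lemma intervalIntegral_le_mul_setIntegral_weight {g w : ℝ → ℝ} {κ x y : ℝ} (hx : 0 < x)
    (hxy : x ≤ y) (hg : Continuous g) (hg0 : ∀ t, 0 ≤ g t) (hw0 : ∀ t, 0 < t → 0 ≤ w t)
    (hκ : 0 ≤ κ) (hgw : IntegrableOn (fun t => g t * w t) (Ioi 0))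
    (hw : ∀ t ∈ Icc x y, 1 ≤ κ * w t) :
    ∫ t in x..y, g t ≤ κ * ∫ t in Ioi (0:ℝ), g t * w t := by
  have hsub : Ioc x y ⊆ Ioi (0:ℝ) := fun t ht => hx.trans ht.1
  rw [intervalIntegral.integral_of_le hxy]
  calc ∫ t in Ioc x y, g t ≤ ∫ t in Ioc x y, κ * (g t * w t) := by
        refine setIntegral_mono_on hg.integrableOn_Ioc ((hgw.mono_set hsub).const_mul κ)
          measurableSet_Ioc fun t ht => ?_
        nlinarith [mul_le_mul_of_nonneg_left (hw t (Ioc_subset_Icc_self ht)) (hg0 t)]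
    _ = κ * ∫ t in Ioc x y, g t * w t := integral_const_mul _ _
    _ ≤ κ * ∫ t in Ioi (0:ℝ), g t * w t := by
        refine mul_le_mul_of_nonneg_left (setIntegral_mono_set hgw ?_ hsub.eventuallyLE) hκ
        filter_upwards [ae_restrict_mem measurableSet_Ioi] with t ht
        exact mul_nonneg (hg0 t) (hw0 t ht)

/-- A local Nash-type bound on an interval where the two weights are bounded below. -/
lemma sq_le_of_weight_lower_bound {f P w : ℝ → ℝ} (hf : ContDiff ℝ 1 f) {κ l x : ℝ}
    (hx : 0 < x) (hl : 0 < l) (hκ : 0 ≤ κ)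
    (hP0 : ∀ t, 0 < t → 0 ≤ P t) (hw0 : ∀ t, 0 < t → 0 ≤ w t)
    (hPint : IntegrableOn (fun t => deriv f t ^ 2 * P t) (Ioi 0))
    (hwint : IntegrableOn (fun t => |f t| * w t) (Ioi 0))
    (hP : ∀ t ∈ Icc x (x+l), 1 ≤ κ * P t) (hw : ∀ t ∈ Icc x (x+l), 1 ≤ κ * w t) :
    f x ^ 2 ≤ 2*l*κ * (∫ t in Ioi (0:ℝ), deriv f t ^ 2 * P t) +
      2*κ^2/l^2 * (∫ t in Ioi (0:ℝ), |f t| * w t) ^ 2 := by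
  have hd : Continuous (deriv f) := hf.continuous_deriv le_rfl
  have hxl : x ≤ x + l := by linarith
  have hB := intervalIntegral_le_mul_setIntegral_weight hx hxl (hd.pow 2)
    (fun t => sq_nonneg _) hP0 hκ hPint hP
  have hD := intervalIntegral_le_mul_setIntegral_weight hx hxl hf.continuous.abs
    (fun t => abs_nonneg _) hw0 hκ hwint hw
  set B := ∫ t in Ioi (0:ℝ), deriv f t ^ 2 * P t
  set D := ∫ t in Ioi (0:ℝ), |f t| * w t
  have hB0 : 0 ≤ κ * B :=
    (intervalIntegral.integral_nonneg hxl fun t _ => sq_nonneg (deriv f t)).trans hB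
  set q := √(l * (κ * B))
  have hq : q ^ 2 = l * (κ * B) := Real.sq_sqrt (by positivity)
  have hosc : ∀ y ∈ Icc x (x+l), |f x| - q ≤ |f y| := by
    intro y hy
    have h1 : (f y - f x) ^ 2 ≤ l * (κ * B) := by
      refine (sq_sub_le_mul_integral_sq_deriv hf hy.1).trans ?_
      have h2 : ∫ t in x..y, deriv f t ^ 2 ≤ ∫ t in x..(x+l), deriv f t ^ 2 :=
        intervalIntegral.integral_mono_interval le_rfl hy.1 hy.2
          (Eventually.of_forall fun t => sq_nonneg _) ((hd.pow 2).intervalIntegrable _ _)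
      have h3 : 0 ≤ ∫ t in x..y, deriv f t ^ 2 :=
        intervalIntegral.integral_nonneg hy.1 fun t _ => sq_nonneg _
      exact mul_le_mul (by linarith [hy.2]) (h2.trans hB) h3 hl.le
    have h4 : |f x - f y| ≤ q := by
      rw [abs_sub_comm]; exact Real.abs_le_sqrt h1
    linarith [abs_sub_abs_le_abs_sub (f x) (f y)]
  have havg : l * (|f x| - q) ≤ κ * D := by
    refine le_trans ?_ hD
    have := intervalIntegral.integral_mono_on (μ := volume) hxl
      (intervalIntegrable_const (c := |f x| - q)) (hf.continuous.abs.intervalIntegrable _ _) hosc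
    rwa [intervalIntegral.integral_const, smul_eq_mul, add_sub_cancel_left] at this
  have hle : |f x| ≤ q + κ * D / l := by
    have : |f x| - q ≤ κ * D / l := by rw [le_div_iff₀ hl]; linarith
    linarith
  calc f x ^ 2 = |f x| ^ 2 := (sq_abs _).symm
    _ ≤ (q + κ * D / l) ^ 2 := by gcongr
    _ ≤ 2 * q^2 + 2 * (κ * D / l)^2 := by linarith [sq_nonneg (q - κ * D / l)]
    _ = _ := by rw [hq]; ring

/-- The derivative of `f ^ 2 * cirDrift * exp cirExponent`. -/
noncomputable def groundStateFlux (h α δ : ℝ) (f : ℝ → ℝ) (x : ℝ) : ℝ :=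
  2 * f x * deriv f x * cirDrift h α δ x * Real.exp (cirExponent h α δ x) +
    f x ^ 2 * (cirDriftDeriv h α δ x - 2 * cirDrift h α δ x ^ 2) *
      Real.exp (cirExponent h α δ x)

lemma continuousOn_groundStateFlux (h α δ : ℝ) {f : ℝ → ℝ} (hf : ContDiff ℝ 1 f) :
    ContinuousOn (groundStateFlux h α δ f) (Ioi 0) := by
  have hd : Continuous (deriv f) := hf.continuous_deriv le_rfl
  have h1 := hf.continuous.continuousOn (s := Ioi (0:ℝ))
  have h2 := continuousOn_cirDrift h α δ
  have h3 := continuousOn_cirDriftDeriv h α δ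
  have h4 := (continuousOn_cirExponent h α δ).rexp
  have h5 := hd.continuousOn (s := Ioi (0:ℝ))
  unfold groundStateFlux
  fun_prop

lemma integral_groundStateFlux_nonneg {h α δ : ℝ} (h1 : 1 - 2*h ≠ 0) (h2 : 1 - h ≠ 0)
    (hδ : 0 < δ) {f : ℝ → ℝ} (hf : ContDiff ℝ 1 f) {a b : ℝ} (ha : 0 < a) (haα : a ≤ α/δ)
    (hbα : α/δ ≤ b) : 0 ≤ ∫ x in a..b, groundStateFlux h α δ f x := by
  have hab : a ≤ b := haα.trans hbα
  have hsub : uIcc a b ⊆ Ioi (0:ℝ) := by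
    rw [uIcc_of_le hab]; exact fun x hx => ha.trans_le hx.1
  rw [intervalIntegral.integral_eq_sub_of_hasDerivAt
    (f := fun x => f x ^ 2 * cirDrift h α δ x * Real.exp (cirExponent h α δ x))]
  · have hb : 0 ≤ cirDrift h α δ b := by
      rw [div_le_iff₀ hδ] at hbα
      exact mul_nonneg (by linarith) (Real.rpow_nonneg (ha.le.trans hab) _)
    have ha' : cirDrift h α δ a ≤ 0 := by
      rw [le_div_iff₀ hδ] at haα
      exact mul_nonpos_of_nonpos_of_nonneg (by linarith) (Real.rpow_nonneg ha.le _)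
    have k1 : 0 ≤ f b ^ 2 * cirDrift h α δ b * Real.exp (cirExponent h α δ b) := by positivity
    have k2 : f a ^ 2 * cirDrift h α δ a * Real.exp (cirExponent h α δ a) ≤ 0 :=
      mul_nonpos_of_nonpos_of_nonneg (mul_nonpos_of_nonneg_of_nonpos (sq_nonneg _) ha')
        (Real.exp_pos _).le
    linarith
  · intro x hx
    have hx0 : 0 < x := hsub hx
    have d1 : HasDerivAt f (deriv f x) x :=
      (hf.differentiable one_ne_zero).differentiableAt.hasDerivAt
    refine (((d1.pow 2).mul (hasDerivAt_cirDrift h α δ hx0)).mul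
      (hasDerivAt_cirExponent α δ h1 h2 hx0).exp).congr_deriv ?_
    simp only [groundStateFlux, Pi.mul_apply, Pi.pow_apply]
    push_cast
    ring
  · exact ((continuousOn_groundStateFlux h α δ hf).mono hsub).intervalIntegrable

lemma sq_mul_potential_le (h α δ : ℝ) (f : ℝ → ℝ) (x : ℝ) :
    f x ^ 2 * (cirDrift h α δ x ^ 2 - cirDriftDeriv h α δ x) *
        Real.exp (cirExponent h α δ x) ≤
      deriv f x ^ 2 * Real.exp (cirExponent h α δ x) - groundStateFlux h α δ f x := by
  rw [groundStateFlux]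
  linarith [mul_nonneg (sq_nonneg (deriv f x - f x * cirDrift h α δ x))
    (Real.exp_pos (cirExponent h α δ x)).le]

lemma integrableOn_mul_of_hasCompactSupport {g w : ℝ → ℝ} (hg : Continuous g)
    (hgs : HasCompactSupport g) {s : Set ℝ} (hw : IntegrableOn w s) :
    IntegrableOn (fun x => g x * w x) s := by
  obtain ⟨C, hC⟩ := hgs.exists_bound_of_continuous hg
  exact hw.bdd_mul hg.aestronglyMeasurable (Eventually.of_forall hC)

lemma setIntegral_Ioi_le_of_forall_intervalIntegral_le {g : ℝ → ℝ} {c m : ℝ} (hc : 0 < c)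
    (hg : IntegrableOn g (Ioi 0))
    (hm : ∀ a b : ℝ, 0 < a → a ≤ c → c ≤ b → ∫ x in a..b, g x ≤ m) :
    ∫ x in Ioi (0:ℝ), g x ≤ m := by
  have ha : Tendsto (fun n : ℕ => 1 / ((n:ℝ) + 1)) atTop (𝓝 0) :=
    tendsto_one_div_add_atTop_nhds_zero_nat
  have hb : Tendsto (fun n : ℕ => (n:ℝ)) atTop atTop := tendsto_natCast_atTop_atTop
  have hcov := (aecover_Ioi_of_Ioi (μ := volume) ha).inter
    (aecover_Iic (μ := volume.restrict (Ioi (0:ℝ))) hb)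
  refine le_of_tendsto (hcov.integral_tendsto_of_countably_generated hg) ?_
  filter_upwards [ha.eventually_le_const hc, hb.eventually_ge_atTop c] with n hn hn'
  have hpos : (0:ℝ) < 1 / ((n:ℝ) + 1) := by positivity
  have hsub : Ioc (1 / ((n:ℝ) + 1)) (n:ℝ) ⊆ Ioi 0 := fun x hx => hpos.trans hx.1
  rw [Measure.restrict_restrict (measurableSet_Ioi.inter measurableSet_Iic), Ioi_inter_Iic,
    inter_eq_left.2 hsub,
    ← intervalIntegral.integral_of_le (hn.trans hn')]
  exact hm _ _ hpos hn hn'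

/-- If `f ^ 2` is controlled by a constant and by the potential, integrate the bound against the
unnormalized density. -/
lemma integral_sq_mul_etaT_le {h α δ C₁ C₂ R T : ℝ} (hh1 : 1/2 < h) (hh2 : h < 1) (hα : 0 < α)
    (hδ : 0 < δ) (hC₁ : 0 ≤ C₁) (hR : 0 < R) (hRC : 2*C₂ ≤ R) (hT : 0 ≤ T)
    (hpot : ∀ x : ℝ, 0 < x → (x ^ (-(2*h)) + x ^ (2-2*h)) * x ^ (-(2*h)) ≤
        C₁ * (cirDrift h α δ x ^ 2 - cirDriftDeriv h α δ x) + C₂ * x ^ (-(2*h)))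
    {f : ℝ → ℝ} (hf : ContDiff ℝ 1 f)
    (hη : IntegrableOn (etaT h α δ) (Ioi 0))
    (hA : IntegrableOn (fun x => f x ^ 2 * etaT h α δ x) (Ioi 0))
    (hB : IntegrableOn (fun x => deriv f x ^ 2 * Real.exp (cirExponent h α δ x)) (Ioi 0))
    (hfT : ∀ x : ℝ, 0 < x → R * f x ^ 2 ≤ R * T + f x ^ 2 * (x ^ (-(2*h)) + x ^ (2-2*h))) :
    R * (∫ x in Ioi (0:ℝ), f x ^ 2 * etaT h α δ x) ≤ 2*R*T * Zcst h α δ +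
      2*C₁ * ∫ x in Ioi (0:ℝ), deriv f x ^ 2 * Real.exp (cirExponent h α δ x) := by
  have hpt : ∀ x : ℝ, 0 < x → R * (f x ^ 2 * etaT h α δ x) ≤ 2*R*T * etaT h α δ x +
      (2*C₁ * (deriv f x ^ 2 * Real.exp (cirExponent h α δ x)) -
        2*C₁ * groundStateFlux h α δ f x) := by
    intro x hx
    have hE := Real.exp_pos (cirExponent h α δ x)
    have hηx := etaT_pos h α δ hx
    have k1 := mul_le_mul_of_nonneg_right (hfT x hx) hηx.le
    have k2 := mul_le_mul_of_nonneg_right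
      (mul_le_mul_of_nonneg_left (hpot x hx) (sq_nonneg (f x))) hE.le
    have k3 := mul_le_mul_of_nonneg_left (sq_mul_potential_le h α δ f x) hC₁
    have k4 := mul_le_mul_of_nonneg_right hRC (mul_nonneg (sq_nonneg (f x)) hηx.le)
    rw [etaT_eq] at k1 k4 ⊢
    linarith
  rw [← le_div_iff₀' hR]
  refine setIntegral_Ioi_le_of_forall_intervalIntegral_le (c := α/δ) (by positivity) hA ?_
  intro a b ha haα hbα
  have hab : a ≤ b := haα.trans hbα
  have hsub : Ioc a b ⊆ Ioi (0:ℝ) := fun x hx => ha.trans hx.1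
  have hsub' : uIcc a b ⊆ Ioi (0:ℝ) := by
    rw [uIcc_of_le hab]; exact fun x hx => ha.trans_le hx.1
  have iη : IntervalIntegrable (etaT h α δ) volume a b :=
    (intervalIntegrable_iff_integrableOn_Ioc_of_le hab).2 (hη.mono_set hsub)
  have iA : IntervalIntegrable (fun x => f x ^ 2 * etaT h α δ x) volume a b :=
    (intervalIntegrable_iff_integrableOn_Ioc_of_le hab).2 (hA.mono_set hsub)
  have iB : IntervalIntegrable (fun x => deriv f x ^ 2 * Real.exp (cirExponent h α δ x))
      volume a b :=
    (intervalIntegrable_iff_integrableOn_Ioc_of_le hab).2 (hB.mono_set hsub)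
  have iG : IntervalIntegrable (groundStateFlux h α δ f) volume a b :=
    ((continuousOn_groundStateFlux h α δ hf).mono hsub').intervalIntegrable
  have hmono := intervalIntegral.integral_mono_on hab (iA.const_mul R)
    ((iη.const_mul (2*R*T)).add ((iB.const_mul (2*C₁)).sub (iG.const_mul (2*C₁))))
    (fun x hx => hpt x (ha.trans_le hx.1))
  rw [intervalIntegral.integral_add (iη.const_mul _)
    ((iB.const_mul (2*C₁)).sub (iG.const_mul (2*C₁))),
    intervalIntegral.integral_sub (iB.const_mul _) (iG.const_mul _)] at hmono
  simp only [intervalIntegral.integral_const_mul] at hmono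
  have hG := integral_groundStateFlux_nonneg (h := h) (α := α) (by linarith) (by linarith) hδ hf
    ha haα hbα
  have hZ : ∫ x in a..b, etaT h α δ x ≤ Zcst h α δ := by
    rw [intervalIntegral.integral_of_le hab]
    refine setIntegral_mono_set hη ?_ hsub.eventuallyLE
    filter_upwards [ae_restrict_mem measurableSet_Ioi] with t ht
    exact (etaT_pos h α δ ht).le
  have hB' : ∫ x in a..b, deriv f x ^ 2 * Real.exp (cirExponent h α δ x) ≤
      ∫ x in Ioi (0:ℝ), deriv f x ^ 2 * Real.exp (cirExponent h α δ x) := by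
    rw [intervalIntegral.integral_of_le hab]
    exact setIntegral_mono_set hB (Eventually.of_forall fun t => by positivity)
      hsub.eventuallyLE
  rw [le_div_iff₀' hR]
  have k1 := mul_le_mul_of_nonneg_left hZ (show 0 ≤ 2*R*T by positivity)
  have k2 := mul_le_mul_of_nonneg_left hB' (show 0 ≤ 2*C₁ by positivity)
  have k3 := mul_nonneg (show 0 ≤ 2*C₁ by positivity) hG
  linarith

/-- The choice of constants turning the localized bound into a super Poincaré inequality with
rate `exp (C * (1 + 1/r))`. -/
lemma superPoincare_of_constants {c C₁ C₂ Z r A B D R K l T : ℝ} (hc : 0 ≤ c) (hC₁ : 0 ≤ C₁)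
    (hC₂ : 0 ≤ C₂) (hZ : 0 < Z) (hr : 0 < r) (hB0 : 0 ≤ B) (hR : 0 < R)
    (hRdef : R = 2*C₂ + 8*C₁/r + 1) (hKdef : K = c * (2*R+1))
    (hldef : l = Real.exp (-K - 16*Z - 1/r))
    (hTdef : T = 2*l*Real.exp K * B + 2*(Real.exp K)^2/l^2 * D ^ 2)
    (hmain : R * A ≤ 2*R*T*Z + 2*C₁*B) :
    Z * A ≤ Z * (r/2 * B) +
      Real.exp ((4*c*(4*C₂+3) + 64*c*C₁ + 64*Z + 2) * (1 + 1/r)) * D ^ 2 := by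
  have hC₁R : 2*C₁ ≤ R * (r/4) := by
    have : 8*C₁/r * r = 8*C₁ := by field_simp
    have h2 : 0 ≤ C₂ * r := by positivity
    rw [hRdef]
    linarith
  have hA' : A ≤ 2*T*Z + r/4 * B := by
    refine le_of_mul_le_mul_left ?_ hR
    have := mul_le_mul_of_nonneg_right hC₁R hB0
    linarith
  have hlK : l * Real.exp K = Real.exp (-(16*Z)) * Real.exp (-(1/r)) := by
    rw [hldef, ← Real.exp_add, ← Real.exp_add]; congr 1; ring
  have hsmall : ∀ s : ℝ, 0 < s → s * Real.exp (-s) ≤ 1 := by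
    intro s hs
    rw [Real.exp_neg, ← div_eq_mul_inv, div_le_one (Real.exp_pos _)]
    linarith [Real.add_one_le_exp s]
  have hlZ : 4*l*Real.exp K * Z ≤ r/4 := by
    have s1 := hsmall (16*Z) (by positivity)
    have s2 := hsmall (1/r) (by positivity)
    have s3 := mul_le_mul s1 s2 (by positivity) zero_le_one
    have s4 := mul_le_mul_of_nonneg_left s3 hr.le
    have s5 : r * (16*Z*Real.exp (-(16*Z)) * (1/r * Real.exp (-(1/r)))) =
        16*Z*(l * Real.exp K) := by rw [hlK]; field_simp
    rw [s5] at s4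
    linarith
  have hconst : 4*Z^2*((Real.exp K)^2/l^2) ≤
      Real.exp ((4*c*(4*C₂+3) + 64*c*C₁ + 64*Z + 2) * (1 + 1/r)) := by
    have t1 : (Real.exp K)^2/l^2 = Real.exp (4*K + 32*Z + 2/r) := by
      rw [hldef, ← div_pow, ← Real.exp_sub, ← Real.exp_nat_mul]
      congr 1; push_cast; ring
    have t2 : 4*Z^2 ≤ Real.exp (4*Z) := by
      have : 2*Z ≤ Real.exp (2*Z) := by linarith [Real.add_one_le_exp (2*Z)]
      calc 4*Z^2 = (2*Z)*(2*Z) := by ring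
        _ ≤ Real.exp (2*Z) * Real.exp (2*Z) := by gcongr
        _ = _ := by rw [← Real.exp_add]; congr 1; ring
    rw [t1]
    calc _ ≤ Real.exp (4*Z) * Real.exp (4*K + 32*Z + 2/r) := by gcongr
      _ = Real.exp (4*Z + (4*K + 32*Z + 2/r)) := by rw [← Real.exp_add]
      _ ≤ _ := by
        apply Real.exp_le_exp.2
        have e : 4*K = 4*c*(4*C₂+3) + 64*c*C₁*(1/r) := by rw [hKdef, hRdef]; ring
        have hr' : 0 < 1/r := by positivity
        have u1 : 0 ≤ 4*c*(4*C₂+3)*(1/r) := by positivity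
        have u2 : 0 ≤ 64*Z*(1/r) := by positivity
        have u3 : 0 ≤ 64*c*C₁ := by positivity
        have u4 : 2/r = 2*(1/r) := by ring
        rw [e, u4]
        linarith
  calc Z * A ≤ Z * (2*T*Z + r/4*B) := by gcongr
    _ = Z * ((4*l*Real.exp K*Z) * B + r/4*B) + 4*Z^2*((Real.exp K)^2/l^2) * D^2 := by
        rw [hTdef]; ring
    _ ≤ Z * (r/4 * B + r/4*B) +
        Real.exp ((4*c*(4*C₂+3) + 64*c*C₁ + 64*Z + 2) * (1 + 1/r)) * D^2 := by gcongr
    _ = _ := by ring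

/-- Super Poincaré inequality for the unnormalized density. -/
lemma exists_superPoincare_etaT {h α δ : ℝ} (hh1 : 1/2 < h) (hh2 : h < 1) (hα : 0 < α)
    (hδ : 0 < δ) (hη : IntegrableOn (etaT h α δ) (Ioi 0)) (hZ : 0 < Zcst h α δ) :
    ∃ C : ℝ, 0 < C ∧ ∀ r : ℝ, 0 < r → ∀ f : ℝ → ℝ, ContDiff ℝ 1 f → HasCompactSupport f →
      Zcst h α δ * (∫ x in Ioi (0:ℝ), f x ^ 2 * etaT h α δ x) ≤
        Zcst h α δ * (r/2 * ∫ x in Ioi (0:ℝ), deriv f x ^ 2 * Real.exp (cirExponent h α δ x)) +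
          Real.exp (C * (1 + 1/r)) * (∫ x in Ioi (0:ℝ), |f x| * etaT h α δ x) ^ 2 := by
  obtain ⟨C₁, C₂, hC₁, hC₂, hpot⟩ := exists_le_potential (δ := δ) hh1 hα hδ
  obtain ⟨c, hc, hlow⟩ := exists_exp_neg_le_weights hh1 hh2 hα hδ
  refine ⟨4*c*(4*C₂+3) + 64*c*C₁ + 64*Zcst h α δ + 2, by positivity, fun r hr f hf hfs => ?_⟩
  have hd : Continuous (deriv f) := hf.continuous_deriv le_rfl
  have hsq : ∀ g : ℝ → ℝ, HasCompactSupport g → HasCompactSupport (fun x => g x ^ 2) :=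
    fun g hg => hg.comp_left (g := fun y : ℝ => y ^ 2) (zero_pow two_ne_zero)
  have habs : HasCompactSupport (fun x => |f x|) :=
    hfs.comp_left (g := fun y : ℝ => |y|) abs_zero
  have hA : IntegrableOn (fun x => f x ^ 2 * etaT h α δ x) (Ioi 0) :=
    integrableOn_mul_of_hasCompactSupport (hf.continuous.pow 2) (hsq f hfs) hη
  have hD : IntegrableOn (fun x => |f x| * etaT h α δ x) (Ioi 0) :=
    integrableOn_mul_of_hasCompactSupport hf.continuous.abs habs hη
  have hB : IntegrableOn (fun x => deriv f x ^ 2 * Real.exp (cirExponent h α δ x)) (Ioi 0) := by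
    have hcont : Continuous (fun x : ℝ => deriv f x ^ 2 * x ^ (2*h)) :=
      (hd.pow 2).mul (Real.continuous_rpow_const (by linarith))
    have hcs : HasCompactSupport (fun x : ℝ => deriv f x ^ 2 * x ^ (2*h)) :=
      (hsq _ hfs.deriv).mul_right
    refine (integrableOn_mul_of_hasCompactSupport hcont hcs hη).congr_fun (fun x hx => ?_)
      measurableSet_Ioi
    simp only [exp_cirExponent_eq h α δ hx, mul_assoc]
  obtain ⟨R, hRdef⟩ : ∃ R : ℝ, R = 2*C₂ + 8*C₁/r + 1 := ⟨_, rfl⟩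
  have hR : 0 < R := by rw [hRdef]; positivity
  obtain ⟨K, hKdef⟩ : ∃ K : ℝ, K = c * (2*R+1) := ⟨_, rfl⟩
  have hK : 0 < K := by rw [hKdef]; positivity
  obtain ⟨l, hldef⟩ : ∃ l : ℝ, l = Real.exp (-K - 16*Zcst h α δ - 1/r) := ⟨_, rfl⟩
  have hl : 0 < l := by rw [hldef]; positivity
  have hl1 : l ≤ 1 := by
    rw [hldef, Real.exp_le_one_iff]
    have : 0 < 1/r := by positivity
    linarith
  have hB0 : 0 ≤ ∫ x in Ioi (0:ℝ), deriv f x ^ 2 * Real.exp (cirExponent h α δ x) :=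
    integral_nonneg fun x => by positivity
  obtain ⟨T, hTdef⟩ : ∃ T : ℝ, T =
      2*l*Real.exp K * (∫ x in Ioi (0:ℝ), deriv f x ^ 2 * Real.exp (cirExponent h α δ x)) +
        2*(Real.exp K)^2/l^2 * (∫ x in Ioi (0:ℝ), |f x| * etaT h α δ x) ^ 2 := ⟨_, rfl⟩
  have hT : 0 ≤ T := by rw [hTdef]; positivity
  have hfT : ∀ x : ℝ, 0 < x →
      R * f x ^ 2 ≤ R * T + f x ^ 2 * (x ^ (-(2*h)) + x ^ (2-2*h)) := by
    intro x hx
    have hp1 : 0 < x ^ (-(2*h)) := by positivity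
    have hp2 : 0 < x ^ (2-2*h) := by positivity
    by_cases hcase : x ^ (-(2*h)) + x ^ (2-2*h) ≤ R
    · have hy : ∀ y ∈ Icc x (x+l), Real.exp (-K) ≤ Real.exp (cirExponent h α δ y) ∧
          Real.exp (-K) ≤ etaT h α δ y := by
        intro y hy
        have hy0 : 0 < y := hx.trans_le hy.1
        rw [hKdef]
        refine hlow (2*R+1) y hy0 ?_
        have q1 : y ^ (-(2*h)) ≤ x ^ (-(2*h)) :=
          Real.rpow_le_rpow_of_nonpos hx hy.1 (by linarith)
        have q2 : y ^ (2-2*h) ≤ x ^ (2-2*h) + 1 := by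
          calc y ^ (2-2*h) ≤ (x + 1) ^ (2-2*h) :=
                Real.rpow_le_rpow hy0.le (by linarith [hy.2]) (by linarith)
            _ ≤ x ^ (2-2*h) + 1 ^ (2-2*h) :=
                Real.rpow_add_le_add_rpow hx.le zero_le_one (by linarith) (by linarith)
            _ = _ := by rw [Real.one_rpow]
        linarith
      have hone : ∀ w : ℝ, Real.exp (-K) ≤ w → 1 ≤ Real.exp K * w := by
        intro w hw
        calc (1:ℝ) = Real.exp K * Real.exp (-K) := by rw [← Real.exp_add]; simp
          _ ≤ _ := by gcongr
      have := sq_le_of_weight_lower_bound hf hx hl (Real.exp_pos K).le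
        (fun t _ => (Real.exp_pos (cirExponent h α δ t)).le)
        (fun t ht => (etaT_pos h α δ ht).le) hB hD
        (fun t ht => hone _ (hy t ht).1) (fun t ht => hone _ (hy t ht).2)
      rw [← hTdef] at this
      have h1 : R * f x ^ 2 ≤ R * T := mul_le_mul_of_nonneg_left this hR.le
      have h2 : 0 ≤ f x ^ 2 * (x ^ (-(2*h)) + x ^ (2-2*h)) := by positivity
      linarith
    · have h1 := mul_le_mul_of_nonneg_left (not_le.1 hcase).le (sq_nonneg (f x))
      have h2 : 0 ≤ R * T := by positivity
      linarith
  have hmain := integral_sq_mul_etaT_le hh1 hh2 hα hδ hC₁.le hR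
    (by rw [hRdef]; have : 0 ≤ 8*C₁/r := by positivity
        linarith) hT hpot hf hη hA hB hfT
  exact superPoincare_of_constants hc.le hC₁.le hC₂ hZ hr hB0 hR hRdef hKdef hldef hTdef hmain

/-- Super Poincaré inequality with rate function `β(r) = exp (C (1 + r⁻¹))` for the
Dirichlet form of the generalized CIR model. -/
theorem stmt_13 (h α δ : ℝ) (hh1 : 1/2 < h) (hh2 : h < 1) (hα : 0 < α) (hδ : 0 < δ) :
    ∃ C : ℝ, 0 < C ∧ ∀ r : ℝ, 0 < r → ∀ f : ℝ → ℝ,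
      ContDiff ℝ 1 f → HasCompactSupport f →
      (∫ x in Set.Ioi (0:ℝ), (f x)^2 * etaN h α δ x) ≤
        (r/2) * (∫ x in Set.Ioi (0:ℝ), x ^ (2*h) * (deriv f x)^2 * etaN h α δ x) +
          Real.exp (C * (1 + 1/r)) * (∫ x in Set.Ioi (0:ℝ), |f x| * etaN h α δ x)^2 := by
  by_cases hZ : Zcst h α δ = 0
  · exact ⟨1, one_pos, fun r _ f _ _ => by simp [etaN, hZ]⟩
  have hη : IntegrableOn (etaT h α δ) (Ioi 0) := not_imp_comm.1 integral_undef hZ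
  have hZ0 : 0 < Zcst h α δ :=
    (setIntegral_nonneg measurableSet_Ioi fun x hx => (etaT_pos h α δ hx).le).lt_of_ne'
      hZ
  obtain ⟨C, hC, hmain⟩ := exists_superPoincare_etaT hh1 hh2 hα hδ hη hZ0
  refine ⟨C, hC, fun r hr f hf hfs => ?_⟩
  have eA : ∫ x in Ioi (0:ℝ), (f x)^2 * etaN h α δ x =
      (∫ x in Ioi (0:ℝ), f x ^ 2 * etaT h α δ x) / Zcst h α δ := by
    simp only [etaN, ← mul_div_assoc, integral_div]
  have eD : ∫ x in Ioi (0:ℝ), |f x| * etaN h α δ x =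
      (∫ x in Ioi (0:ℝ), |f x| * etaT h α δ x) / Zcst h α δ := by
    simp only [etaN, ← mul_div_assoc, integral_div]
  have eB : ∫ x in Ioi (0:ℝ), x ^ (2*h) * (deriv f x)^2 * etaN h α δ x =
      (∫ x in Ioi (0:ℝ), deriv f x ^ 2 * Real.exp (cirExponent h α δ x)) / Zcst h α δ := by
    rw [← integral_div]
    refine setIntegral_congr_fun measurableSet_Ioi fun x hx => ?_
    simp only [exp_cirExponent_eq h α δ hx, etaN]
    ring
  rw [eA, eB, eD]
  have := div_le_div_of_nonneg_right (hmain r hr f hf hfs) (sq_nonneg (Zcst h α δ))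
  refine (Eq.le ?_).trans (this.trans_eq ?_)
  · field_simp
  · field_simp
end
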